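/- For all integers B ≥ 2 and all integers m with 1 ≤ m ≤ B − 1, it holds that sin(π m / B) > 3 / √(2B² + 7). -/

import Mathlib

lemma sin_le_sin_of_le_of_le_pi_sub {x y : ℝ} (hx : 0 ≤ x) (hxy : x ≤ y)
    (hy : y ≤ Real.pi - x) : Real.sin x ≤ Real.sin y := by
  rcases le_total y (Real.pi / 2) with h | h
  · exact Real.sin_le_sin_of_le_of_le_pi_div_two (by linarith [Real.pi_pos]) h hxy
  · rw [← Real.sin_pi_sub y]
    exact Real.sin_le_sin_of_le_of_le_pi_div_two (by linarith [Real.pi_pos])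
      (by linarith) (by linarith)

lemma five_halves_le_mul_sin_pi_div {b : ℝ} (hb : 3 ≤ b) : 5 / 2 ≤ b * Real.sin (Real.pi / b) := by
  have hb0 : 0 < b := by linarith
  have hsin := Real.sin_gt_sub_cube (div_pos Real.pi_pos hb0)
  have hpi := Real.pi_gt_d2
  have hpi' := Real.pi_lt_d2
  have hx : Real.pi / b ≤ 21 / 20 := by
    rw [div_le_iff₀ hb0]; linarith
  have hx0 : 0 < Real.pi / b := div_pos Real.pi_pos hb0
  have hsq : (Real.pi / b) ^ 2 ≤ (21 / 20) ^ 2 := by gcongr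
  calc (5 / 2 : ℝ) ≤ Real.pi * (1 - (21 / 20) ^ 2 / 6) := by linarith
    _ ≤ Real.pi * (1 - (Real.pi / b) ^ 2 / 6) := by gcongr
    _ = b * (Real.pi / b - (Real.pi / b) ^ 3 / 6) := by field_simp
    _ ≤ b * Real.sin (Real.pi / b) := by gcongr

/-- For all integers `B ≥ 2` and `1 ≤ m ≤ B - 1`, one has
`sin(π m / B) > 3 / √(2B² + 7)`. -/
theorem stmt_12 (B m : ℕ) (hB : 2 ≤ B) (hm1 : 1 ≤ m) (hm2 : m ≤ B - 1) :
    Real.sin (Real.pi * m / B) > 3 / Real.sqrt (2 * (B : ℝ) ^ 2 + 7) := by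
  have hB0 : (0 : ℝ) < B := by exact_mod_cast (by omega : 0 < B)
  have hm1' : (1 : ℝ) ≤ m := by exact_mod_cast hm1
  have hm2' : (m : ℝ) + 1 ≤ B := by exact_mod_cast (by omega : m + 1 ≤ B)
  have hpi := Real.pi_pos
  have hmono : Real.sin (Real.pi / B) ≤ Real.sin (Real.pi * m / B) := by
    apply sin_le_sin_of_le_of_le_pi_sub (by positivity)
    · gcongr
      nlinarith
    · rw [le_sub_iff_add_le, ← add_div, div_le_iff₀ hB0]
      nlinarith
  refine lt_of_lt_of_le ?_ hmono
  have hsin0 : 0 ≤ Real.sin (Real.pi / B) :=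
    Real.sin_nonneg_of_nonneg_of_le_pi (by positivity) (div_le_self hpi.le (by linarith))
  rw [div_lt_iff₀ (by positivity)]
  refine lt_of_pow_lt_pow_left₀ 2 (by positivity) ?_
  rw [mul_pow, Real.sq_sqrt (by positivity)]
  rcases hB.eq_or_lt with rfl | hB3
  · norm_num
  · have hmul := five_halves_le_mul_sin_pi_div (b := B) (by exact_mod_cast hB3)
    nlinarith [sq_nonneg (Real.sin (Real.pi / B))]
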